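/- Let J = diag(J₁,…,J₅) and I = diag(I₁,…,I₅) be real diagonal 5×5 matrices with J₁ > J₂ > J₃ > 0 > J₄ > J₅. Fix t ∈ ℝ, μ ∈ ℝ, ν > 0, set λ⁺ = μ + iν and z_k(x) = J_k·x + I_k·t. Let n₀ ∈ ℂ⁵ with (n₀)₄ = (n₀)₅ = 0 and ((n₀)₁,(n₀)₂,(n₀)₃) ≠ 0, define D(x) = Σ_{p=1}^{3} |n₀^p|²·exp(2ν·z_p(x)) and the matrix P(x) with entries P(x)_{ks} = n₀^k·conj(n₀^s)·exp(−iλ⁺·z_k(x) + i·conj(λ⁺)·z_s(x)) / D(x). Let d₀′ ∈ ℂ⁵ have (d₀′)₃ = (n₀)₃ and all other components zero, let v(x) have components v(x)_k = exp(−iλ⁺·z_k(x))·(d₀′)_k, and set f(x) = (1 − P(x))·v(x). Then for every a ∈ ℝ with J₃ < a < J₂, exp(−ν·a·x)·f(x) → 0 both as x → +∞ and as x → −∞. In particular, if a′ = (J₁ + J₂ + J₃)/3 satisfies J₂ > a′, then exp(−ν·a′·x)·f(x) decays in both directions. -/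

import Mathlib

open Filter

theorem aux_top (ν a C b c : ℝ) (hν : 0 < ν) (hb : b < a) :
    Tendsto (fun x : ℝ => Real.exp (-(ν * a * x)) * (C * Real.exp (ν * (b * x + c)))) atTop (nhds 0) := by
  have h : Tendsto (fun x : ℝ => (C * Real.exp (ν * c)) * Real.exp (-(ν * (a - b)) * x)) atTop
      (nhds ((C * Real.exp (ν * c)) * 0)) := by
    apply Tendsto.const_mul
    apply Real.tendsto_exp_atBot.comp
    exact tendsto_id.const_mul_atTop_of_neg (by nlinarith [mul_pos hν (sub_pos.2 hb)])
  rw [mul_zero] at h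
  refine h.congr fun x => ?_
  rw [mul_assoc, ← Real.exp_add, mul_left_comm, ← Real.exp_add]
  ring_nf

theorem aux_bot (ν a C b c : ℝ) (hν : 0 < ν) (hb : a < b) :
    Tendsto (fun x : ℝ => Real.exp (-(ν * a * x)) * (C * Real.exp (ν * (b * x + c)))) atBot (nhds 0) := by
  have h := (aux_top ν (-a) C (-b) c hν (by linarith)).comp tendsto_neg_atBot_atTop
  refine h.congr fun x => ?_
  simp

theorem aux_lim {l : Filter ℝ} (w B g' : ℝ → ℝ) (g : ℝ → ℂ) (hw : ∀ x, 0 ≤ w x)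
    (hg : ∀ x, ‖g x‖ ≤ B x) (h : Tendsto (fun x => w x * B x) l (nhds 0)) :
    Tendsto (fun x => w x • g x) l (nhds 0) := by
  refine squeeze_zero_norm (fun x => ?_) h
  rw [norm_smul, Real.norm_of_nonneg (hw x)]
  exact mul_le_mul_of_nonneg_left (hg x) (hw x)

theorem norm_e (μ ν z : ℝ) :
    ‖Complex.exp (-Complex.I * ((μ : ℂ) + (ν : ℂ) * Complex.I) * (z : ℂ))‖ = Real.exp (ν * z) := by
  rw [Complex.norm_exp]; congr 1; simp

theorem norm_e2 (μ ν z y : ℝ) :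
    ‖Complex.exp (-Complex.I * ((μ : ℂ) + (ν : ℂ) * Complex.I) * (z : ℂ)
      + Complex.I * ((starRingEnd ℂ) ((μ : ℂ) + (ν : ℂ) * Complex.I)) * (y : ℂ))‖
      = Real.exp (ν * z) * Real.exp (ν * y) := by
  rw [Complex.norm_exp, ← Real.exp_add]; congr 1; simp

/-- the generalized eigenfunction `f(x) = (1 - P(x))·v(x)`, built from a
polarization vector supported on the indices `{1,2,3}` (where `J` is positive) and the
secondary splitting part `d₀′` supported on the third index, becomes exponentially
decaying in both directions after multiplication by `exp(-νax)` for any `J₃ < a < J₂`;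
in particular for `a′ = (J₁+J₂+J₃)/3` whenever `J₂ > a′`. -/
theorem stmt_15 (J Iv : Fin 5 → ℝ)
    (hJ : J 0 > J 1 ∧ J 1 > J 2 ∧ J 2 > 0 ∧ (0 : ℝ) > J 3 ∧ J 3 > J 4)
    (t μ ν : ℝ) (hν : 0 < ν)
    (n0 : Fin 5 → ℂ) (h45 : n0 3 = 0 ∧ n0 4 = 0)
    (h123 : ¬(n0 0 = 0 ∧ n0 1 = 0 ∧ n0 2 = 0))
    (D : ℝ → ℝ)
    (hD : ∀ x : ℝ, D x =
      ∑ p ∈ ({0, 1, 2} : Finset (Fin 5)),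
        ‖n0 p‖ ^ 2 * Real.exp (2 * ν * (J p * x + Iv p * t)))
    (P : ℝ → Matrix (Fin 5) (Fin 5) ℂ)
    (hP : ∀ (x : ℝ) (k s : Fin 5), P x k s =
      n0 k * (starRingEnd ℂ) (n0 s) *
        Complex.exp (-Complex.I * ((μ : ℂ) + (ν : ℂ) * Complex.I) * ((J k * x + Iv k * t : ℝ) : ℂ)
          + Complex.I * ((starRingEnd ℂ) ((μ : ℂ) + (ν : ℂ) * Complex.I)) * ((J s * x + Iv s * t : ℝ) : ℂ))
        / ((D x : ℝ) : ℂ))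
    (d0' : Fin 5 → ℂ) (hd0' : d0' = fun k => if k = 2 then n0 2 else 0)
    (f : ℝ → Fin 5 → ℂ)
    (hf : ∀ x : ℝ, f x = (1 - P x).mulVec
      (fun k => Complex.exp (-Complex.I * ((μ : ℂ) + (ν : ℂ) * Complex.I) *
          ((J k * x + Iv k * t : ℝ) : ℂ)) * d0' k)) :
    (∀ a : ℝ, J 2 < a → a < J 1 →
      Tendsto (fun x : ℝ => Real.exp (-(ν * a * x)) • f x) atTop (nhds 0) ∧
      Tendsto (fun x : ℝ => Real.exp (-(ν * a * x)) • f x) atBot (nhds 0)) ∧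
    (J 1 > (J 0 + J 1 + J 2) / 3 →
      Tendsto (fun x : ℝ => Real.exp (-(ν * ((J 0 + J 1 + J 2) / 3) * x)) • f x) atTop (nhds 0) ∧
      Tendsto (fun x : ℝ => Real.exp (-(ν * ((J 0 + J 1 + J 2) / 3) * x)) • f x) atBot (nhds 0)) := by
  obtain ⟨h01, h12, h2, h3, h4⟩ := hJ
  obtain ⟨hn3, hn4⟩ := h45
  have key : ∀ a : ℝ, J 2 < a → a < J 1 →
      Tendsto (fun x : ℝ => Real.exp (-(ν * a * x)) • f x) atTop (nhds 0) ∧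
      Tendsto (fun x : ℝ => Real.exp (-(ν * a * x)) • f x) atBot (nhds 0) := by
    intro a ha2 ha1
    have hfk : ∀ x k, f x k = ((1 : Matrix (Fin 5) (Fin 5) ℂ) k 2 - P x k 2) *
        (Complex.exp (-Complex.I * ((μ : ℂ) + (ν : ℂ) * Complex.I) *
          ((J 2 * x + Iv 2 * t : ℝ) : ℂ)) * n0 2) := by
      intro x k
      rw [hf, hd0']
      simp only [Matrix.mulVec, dotProduct, mul_ite, mul_zero, Finset.sum_ite_eq',
        Finset.mem_univ, if_true, Matrix.sub_apply]
    by_cases hn2 : n0 2 = 0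
    · have hz : ∀ x, f x = 0 := by
        intro x; ext k; rw [hfk, hn2]; simp
      simp [hz]
    have hN2 : 0 < ‖n0 2‖ := norm_pos_iff.2 hn2
    set E : Fin 5 → ℝ → ℝ := fun k x => Real.exp (ν * (J k * x + Iv k * t)) with hE
    have hEpos : ∀ k x, 0 < E k x := fun k x => Real.exp_pos _
    have hDE : ∀ x, D x = ‖n0 0‖ ^ 2 * E 0 x ^ 2 + ‖n0 1‖ ^ 2 * E 1 x ^ 2
        + ‖n0 2‖ ^ 2 * E 2 x ^ 2 := by
      intro x
      rw [hD, Finset.sum_insert (by decide), Finset.sum_insert (by decide), Finset.sum_singleton]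
      simp only [hE, ← Real.exp_nat_mul]
      push_cast
      simp only [← mul_assoc, add_assoc]
    have hq : ∀ k x, 0 ≤ ‖n0 k‖ ^ 2 * E k x ^ 2 := fun k x => by positivity
    have hq2 : ∀ x, 0 < ‖n0 2‖ ^ 2 * E 2 x ^ 2 := fun x =>
      mul_pos (pow_pos hN2 2) (pow_pos (hEpos 2 x) 2)
    have hDpos : ∀ x, 0 < D x := fun x => by
      rw [hDE]; linarith [hq 0 x, hq 1 x, hq2 x]
    have hnv : ∀ x, ‖Complex.exp (-Complex.I * ((μ : ℂ) + (ν : ℂ) * Complex.I) *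
          ((J 2 * x + Iv 2 * t : ℝ) : ℂ)) * n0 2‖ = E 2 x * ‖n0 2‖ := by
      intro x; rw [norm_mul, norm_e]
    have hP22 : ∀ x, P x 2 2 = ((‖n0 2‖ ^ 2 * E 2 x ^ 2 / D x : ℝ) : ℂ) := by
      intro x
      rw [hP, Complex.mul_conj, Complex.normSq_eq_norm_sq]
      push_cast
      congr 2
      simp only [hE]
      push_cast
      rw [← Complex.exp_nat_mul]
      congr 1
      simp
      linear_combination (-2 * (ν : ℂ) * (J 2 * x + Iv 2 * t)) * Complex.I_sq
    have hf2 : ∀ x, ‖f x 2‖ = (‖n0 0‖ ^ 2 * E 0 x ^ 2 + ‖n0 1‖ ^ 2 * E 1 x ^ 2) / D x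
        * (E 2 x * ‖n0 2‖) := by
      intro x
      have h1 : (1 : ℂ) - ((‖n0 2‖ ^ 2 * E 2 x ^ 2 / D x : ℝ) : ℂ)
          = (((‖n0 0‖ ^ 2 * E 0 x ^ 2 + ‖n0 1‖ ^ 2 * E 1 x ^ 2) / D x : ℝ) : ℂ) := by
        rw [← Complex.ofReal_one, ← Complex.ofReal_sub]
        congr 1
        rw [eq_div_iff (hDpos x).ne', sub_mul, div_mul_cancel₀ _ (hDpos x).ne', hDE]
        ring
      rw [hfk, norm_mul, hnv, hP22, Matrix.one_apply_eq, h1, Complex.norm_real, Real.norm_of_nonneg]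
      exact div_nonneg (add_nonneg (hq 0 x) (hq 1 x)) (hDpos x).le
    have hfk' : ∀ k x, k ≠ 2 → ‖f x k‖ = ‖n0 k‖ * ‖n0 2‖ ^ 2 * E k x * E 2 x ^ 2 / D x := by
      intro k x hk
      rw [hfk, norm_mul, hnv, Matrix.one_apply_ne hk, zero_sub, norm_neg, hP, norm_div, norm_mul,
        norm_e2, norm_mul, RCLike.norm_conj, Complex.norm_real, Real.norm_of_nonneg (hDpos x).le]
      simp only [hE]
      ring
    -- bounds
    have b2top : ∀ x, ‖f x 2‖ ≤ ‖n0 2‖ * Real.exp (ν * (J 2 * x + Iv 2 * t)) := by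
      intro x
      rw [hf2, mul_comm (E 2 x)]
      apply mul_le_of_le_one_left (mul_pos hN2 (hEpos 2 x)).le
      rw [div_le_one (hDpos x), hDE]
      linarith [hq2 x]
    have hexp : ∀ i j x, E i x ^ 2 / E j x =
        Real.exp (ν * ((2 * J i - J j) * x + (2 * Iv i - Iv j) * t)) := by
      intro i j x
      simp only [hE, ← Real.exp_nat_mul, ← Real.exp_sub]
      congr 1; push_cast; ring
    have b2bot : ∀ x, ‖f x 2‖ ≤
        ‖n0 0‖ ^ 2 / ‖n0 2‖ * Real.exp (ν * ((2 * J 0 - J 2) * x + (2 * Iv 0 - Iv 2) * t))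
        + ‖n0 1‖ ^ 2 / ‖n0 2‖ * Real.exp (ν * ((2 * J 1 - J 2) * x + (2 * Iv 1 - Iv 2) * t)) := by
      intro x
      rw [hf2, ← hexp, ← hexp]
      have hE2 := hEpos 2 x
      have h1 : ‖n0 0‖ ^ 2 / ‖n0 2‖ * (E 0 x ^ 2 / E 2 x) + ‖n0 1‖ ^ 2 / ‖n0 2‖ * (E 1 x ^ 2 / E 2 x)
          = (‖n0 0‖ ^ 2 * E 0 x ^ 2 + ‖n0 1‖ ^ 2 * E 1 x ^ 2) / (‖n0 2‖ ^ 2 * E 2 x ^ 2)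
            * (E 2 x * ‖n0 2‖) := by
        field_simp
      rw [h1]
      apply mul_le_mul_of_nonneg_right _ (mul_pos hE2 hN2).le
      apply div_le_div_of_nonneg_left (add_nonneg (hq 0 x) (hq 1 x)) (hq2 x)
      rw [hDE]; linarith [hq 0 x, hq 1 x]
    have bkbot : ∀ k x, k ≠ 2 → ‖f x k‖ ≤ ‖n0 k‖ * Real.exp (ν * (J k * x + Iv k * t)) := by
      intro k x hk
      rw [hfk' k x hk, div_le_iff₀ (hDpos x)]
      have : ‖n0 2‖ ^ 2 * E 2 x ^ 2 ≤ D x := by rw [hDE]; linarith [hq 0 x, hq 1 x]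
      have := mul_le_mul_of_nonneg_left this (mul_nonneg (norm_nonneg (n0 k)) (hEpos k x).le)
      calc _ = ‖n0 k‖ * E k x * (‖n0 2‖ ^ 2 * E 2 x ^ 2) := by ring
        _ ≤ _ := this
    have bktop : ∀ k x, k ≠ 2 → ‖f x k‖ ≤ ‖n0 2‖ ^ 2 / ‖n0 k‖ *
        Real.exp (ν * ((2 * J 2 - J k) * x + (2 * Iv 2 - Iv k) * t)) := by
      intro k x hk
      rw [hfk' k x hk, ← hexp]
      by_cases hnk : n0 k = 0
      · simp [hnk]
      have hNk : 0 < ‖n0 k‖ := norm_pos_iff.2 hnk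
      have hEk := hEpos k x
      have hle : ‖n0 k‖ ^ 2 * E k x ^ 2 ≤ D x := by
        rw [hDE]
        have := hq 0 x
        have := hq 1 x
        have := hq2 x
        fin_cases k
        · simp; linarith
        · simp; linarith
        · exact absurd rfl hk
        · exact absurd hn3 hnk
        · exact absurd hn4 hnk
      have h1 : ‖n0 2‖ ^ 2 / ‖n0 k‖ * (E 2 x ^ 2 / E k x) =
          ‖n0 k‖ * ‖n0 2‖ ^ 2 * E k x * E 2 x ^ 2 / (‖n0 k‖ ^ 2 * E k x ^ 2) := by
        field_simp
      rw [h1]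
      apply div_le_div_of_nonneg_left _ (by positivity) hle
      have := hEpos 2 x
      positivity
    have hz : ∀ k x, n0 k = 0 → k ≠ 2 → f x k = 0 := by
      intro k x h hk
      rw [← norm_eq_zero, hfk' k x hk, h]; simp
    have hw : ∀ x, 0 ≤ Real.exp (-(ν * a * x)) := fun x => (Real.exp_pos _).le
    constructor
    · rw [tendsto_pi_nhds]
      intro k
      simp only [Pi.smul_apply, Pi.zero_apply]
      have hk2 : ∀ k, k ≠ 2 → a < J k →
          Tendsto (fun x => Real.exp (-(ν * a * x)) • f x k) atTop (nhds 0) := fun k hk hak =>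
        aux_lim _ _ (fun _ => 0) _ hw (fun x => bktop k x hk) (aux_top _ _ _ _ _ hν (by linarith))
      fin_cases k
      · exact hk2 0 (by decide) (by linarith)
      · exact hk2 1 (by decide) (by linarith)
      · exact aux_lim _ _ (fun _ => 0) _ hw b2top (aux_top _ _ _ _ _ hν (by linarith))
      · simp [hz 3 _ hn3]
      · simp [hz 4 _ hn4]
    · rw [tendsto_pi_nhds]
      intro k
      simp only [Pi.smul_apply, Pi.zero_apply]
      have hk2 : ∀ k, k ≠ 2 → a < J k →
          Tendsto (fun x => Real.exp (-(ν * a * x)) • f x k) atBot (nhds 0) := fun k hk hak =>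
        aux_lim _ _ (fun _ => 0) _ hw (fun x => bkbot k x hk) (aux_bot _ _ _ _ _ hν (by linarith))
      fin_cases k
      · exact hk2 0 (by decide) (by linarith)
      · exact hk2 1 (by decide) (by linarith)
      · refine aux_lim _ _ (fun _ => 0) _ hw b2bot ?_
        simp only [mul_add (Real.exp (-(ν * a * _)))]
        rw [← add_zero (0 : ℝ)]
        exact (aux_bot _ _ _ _ _ hν (by linarith)).add (aux_bot _ _ _ _ _ hν (by linarith))
      · simp [hz 3 _ hn3]
      · simp [hz 4 _ hn4]
  exact ⟨key, fun h => key _ (by linarith) h⟩
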